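/- Let 1 < p < ∞ and suppose the n-tuple x = (x_1,…,x_n) of points of ℓ_p has Property K. Then there exist N ∈ ℕ and vectors y_1,…,y_n ∈ ℓ_p^N such that ‖y_i − y_j‖_p = ‖x_i − x_j‖_p for all i,j and the n-tuple (y_1,…,y_n) has Property K. -/

import Mathlib

open MeasureTheory
open scoped ENNReal
noncomputable section

/-- The index set of pairs `(i,j)` with `i < j`, indexing the coordinates of
`ℝ^{n(n-1)/2}`. -/
abbrev PairIdx (n : ℕ) := {q : Fin n × Fin n // q.1 < q.2}

/-- `‖v‖_p` for `v ∈ ℝ^n`. -/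
def pNorm (p : ℝ) {n : ℕ} (v : Fin n → ℝ) : ℝ := (∑ k, |v k| ^ p) ^ (1 / p)

/-- The map `F_n : (ℝ^n)^n → ℝ^{n(n-1)/2}`, `F_n(x₁,…,xₙ) = (‖x_i - x_j‖_p^p)_{i<j}`. -/
def Fmap (p : ℝ) (n : ℕ) (x : Fin n → Fin n → ℝ) : PairIdx n → ℝ :=
  fun q => ∑ k, |x q.val.1 k - x q.val.2 k| ^ p

/-- `G_n`: the set of points of `(ℝ^n)^n` where the derivative of `F_n` has full rank
`n(n-1)/2`. -/
def Gset (p : ℝ) (n : ℕ) : Set (Fin n → Fin n → ℝ) :=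
  {x | LinearMap.rank (fderiv ℝ (Fmap p n) x).toLinearMap = ((n * (n - 1) / 2 : ℕ) : Cardinal)}

/-- Property K for an `n`-tuple of points of `ℓ_p` (given by their coordinates). -/
def PropertyKSeq (p : ℝ) (n : ℕ) (x : Fin n → ℕ → ℝ) : Prop :=
  ∃ m : Fin n → ℕ, StrictMono m ∧ (fun i j => x i (m j)) ∈ Gset p n

/-- Property K for an `n`-tuple of points of `ℓ_p^N`. -/
def PropertyKFin (p : ℝ) (n N : ℕ) (x : Fin n → Fin N → ℝ) : Prop :=
  ∃ m : Fin n → Fin N, StrictMono m ∧ (fun i j => x i (m j)) ∈ Gset p n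

/-- A Borel set `A` in a (separable) Banach space is Haar null if there is a Borel
probability measure `μ` with `μ(x + A) = 0` for all `x`. -/
def HaarNull {X : Type*} [AddGroup X] [MeasurableSpace X] (A : Set X) : Prop :=
  ∃ μ : Measure X, IsProbabilityMeasure μ ∧ ∀ x : X, μ ((fun a => x + a) '' A) = 0

/-- `X` uniformly contains the spaces `ℓ_p^m`, `m ∈ ℕ`. -/
def UnifContainsLp (p : ℝ≥0∞) [Fact (1 ≤ p)] (X : Type*) [NormedAddCommGroup X]
    [NormedSpace ℝ X] : Prop :=
  ∃ C : ℝ, 1 ≤ C ∧ ∀ m : ℕ, ∃ (Y : Submodule ℝ X)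
    (T : PiLp p (fun _ : Fin m => ℝ) ≃L[ℝ] Y),
      ‖(T : PiLp p (fun _ : Fin m => ℝ) →L[ℝ] Y)‖ *
        ‖(T.symm : Y →L[ℝ] PiLp p (fun _ : Fin m => ℝ))‖ ≤ C

-- test lp coercion and instances

theorem card_pairIdx (n : ℕ) : Fintype.card (PairIdx n) = n * (n - 1) / 2 := by
  have e : PairIdx n ≃ Σ j : Fin n, {i : Fin n // i < j} :=
    { toFun := fun q => ⟨q.1.2, q.1.1, q.2⟩
      invFun := fun q => ⟨(q.2.1, q.1), q.2.2⟩
      left_inv := fun _ => rfl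
      right_inv := fun _ => rfl }
  have h (j : Fin n) : Fintype.card {i : Fin n // i < j} = (j : ℕ) := by
    rw [Fintype.card_subtype, ← Fin.card_Iio j]
    congr 1
    ext i
    simp
  rw [Fintype.card_congr e, Fintype.card_sigma, ← Finset.sum_range_id,
    ← Fin.sum_univ_eq_sum_range (fun i => i)]
  exact Finset.sum_congr rfl fun j _ => h j

theorem rank_pairIdx_fun (n : ℕ) :
    Module.rank ℝ (PairIdx n → ℝ) = ((n * (n - 1) / 2 : ℕ) : Cardinal) := by
  rw [← card_pairIdx n]
  exact rank_fun'

theorem contDiff_Fmap {p : ℝ} (hp : 1 < p) (n : ℕ) : ContDiff ℝ 1 (Fmap p n) := by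
  have h : ContDiff ℝ 1 fun t : ℝ => |t| ^ p := by
    simpa only [Real.norm_eq_abs] using contDiff_norm_rpow (E := ℝ) hp
  rw [contDiff_pi]
  intro q
  unfold Fmap
  refine ContDiff.sum fun k _ => h.comp ?_
  fun_prop

theorem mem_Gset_iff_le_rank {p : ℝ} {n : ℕ} {a : Fin n → Fin n → ℝ} :
    a ∈ Gset p n ↔ ((n * (n - 1) / 2 : ℕ) : Cardinal) ≤
      LinearMap.rank (fderiv ℝ (Fmap p n) a).toLinearMap := by
  refine ⟨fun h => h.ge, fun h => le_antisymm ?_ h⟩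
  rw [← rank_pairIdx_fun n]
  exact LinearMap.rank_le_range _

theorem range_fderiv_Fmap_eq_top {p : ℝ} {n : ℕ} {a : Fin n → Fin n → ℝ} (ha : a ∈ Gset p n) :
    (fderiv ℝ (Fmap p n) a).range = ⊤ := by
  apply Submodule.eq_top_of_finrank_eq
  have h : Module.rank ℝ (fderiv ℝ (Fmap p n) a).range = Module.rank ℝ (PairIdx n → ℝ) := by
    rw [rank_pairIdx_fun n]
    exact ha
  exact congrArg Cardinal.toNat h

theorem isOpen_Gset {p : ℝ} (hp : 1 < p) (n : ℕ) : IsOpen (Gset p n) := by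
  have h : Gset p n = (fderiv ℝ (Fmap p n)) ⁻¹'
      {f | ((n * (n - 1) / 2 : ℕ) : Cardinal) ≤ LinearMap.rank f.toLinearMap} := by
    ext a
    exact mem_Gset_iff_le_rank
  rw [h]
  exact (isOpen_setOfPred_nat_le_rank _).preimage ((contDiff_Fmap hp n).continuous_fderiv one_ne_zero)

/-- Near a point of `G_n`, the map `F_n` is open, with preimages that stay in `G_n`. -/
theorem image_Gset_mem_nhds {p : ℝ} (hp : 1 < p) {n : ℕ} {a : Fin n → Fin n → ℝ}
    (ha : a ∈ Gset p n) : Fmap p n '' Gset p n ∈ nhds (Fmap p n a) := by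
  have hs : HasStrictFDerivAt (Fmap p n) (fderiv ℝ (Fmap p n) a) a :=
    (contDiff_Fmap hp n).contDiffAt.hasStrictFDerivAt one_ne_zero
  rw [← hs.map_nhds_eq_of_surj (range_fderiv_Fmap_eq_top ha)]
  exact Filter.image_mem_map ((isOpen_Gset hp n).mem_nhds ha)

/-- Changing the coordinates of two sequences along an injection `m` changes sums over a set
containing the range of `m` only through the coordinates in that range. -/
theorem sum_extend_sub {n : ℕ} {m : Fin n → ℕ} (hm : Function.Injective m) {K : ℕ}
    (hK : ∀ j, m j < K) (φ : ℝ → ℝ) (u v : Fin n → ℝ) (f g : ℕ → ℝ) :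
    ∑ k ∈ Finset.range K, φ (Function.extend m u f k - Function.extend m v g k) =
      ∑ k ∈ Finset.range K, φ (f k - g k) + ∑ j, φ (u j - v j) - ∑ j, φ (f (m j) - g (m j)) := by
  have hsub : Finset.univ.map ⟨m, hm⟩ ⊆ Finset.range K := by
    intro k hk
    obtain ⟨j, -, rfl⟩ := Finset.mem_map.1 hk
    exact Finset.mem_range.2 (hK j)
  rw [← Finset.sum_sdiff hsub, ← Finset.sum_sdiff hsub (f := fun k => φ (f k - g k)),
    Finset.sum_map, Finset.sum_map]
  have h : ∑ k ∈ Finset.range K \ Finset.univ.map ⟨m, hm⟩,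
      φ (Function.extend m u f k - Function.extend m v g k) =
      ∑ k ∈ Finset.range K \ Finset.univ.map ⟨m, hm⟩, φ (f k - g k) := by
    refine Finset.sum_congr rfl fun k hk => ?_
    have hk' : ¬ ∃ j, m j = k := by simpa using (Finset.mem_sdiff.1 hk).2
    rw [Function.extend_apply' _ _ _ hk', Function.extend_apply' _ _ _ hk']
  rw [h]
  simp only [Function.Embedding.coeFn_mk, hm.extend_apply]
  ring

theorem pNorm_sub_comm (p : ℝ) {N : ℕ} (u v : Fin N → ℝ) : pNorm p (u - v) = pNorm p (v - u) := by
  simp only [pNorm, Pi.sub_apply, abs_sub_comm]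

theorem pNorm_sub_self {p : ℝ} (hp : 0 < p) {N : ℕ} (u : Fin N → ℝ) : pNorm p (u - u) = 0 := by
  simp [pNorm, Real.zero_rpow hp.ne', Real.zero_rpow (inv_pos.2 hp).ne']

/-- If an `n`-tuple `x` in `ℓ_p` has Property K, then there are `N ∈ ℕ`
and `y₁,…,yₙ ∈ ℓ_p^N` with `‖y_i - y_j‖_p = ‖x_i - x_j‖_p` for all `i, j`, such that
`(y₁,…,yₙ)` has Property K. -/
theorem stmt5 (p : ℝ) (hp : 1 < p) [Fact (1 ≤ ENNReal.ofReal p)] (n : ℕ)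
    (x : Fin n → lp (fun _ : ℕ => ℝ) (ENNReal.ofReal p))
    (hx : PropertyKSeq p n (fun i k => x i k)) :
    ∃ (N : ℕ) (y : Fin n → Fin N → ℝ),
      (∀ i j, pNorm p (y i - y j) = ‖x i - x j‖) ∧ PropertyKFin p n N y := by
  obtain ⟨m, hm, ha⟩ := hx
  have hp0 : 0 < p := one_pos.trans hp
  have hpr : (ENNReal.ofReal p).toReal = p := ENNReal.toReal_ofReal hp0.le
  have hsum (i j : Fin n) : Summable fun k => |x i k - x j k| ^ p := by
    simpa [hpr] using (lp.memℓp (x i - x j)).summable (by rwa [hpr])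
  have hnorm (i j : Fin n) : ‖x i - x j‖ = (∑' k, |x i k - x j k| ^ p) ^ (1 / p) := by
    simpa [hpr] using lp.norm_eq_tsum_rpow (by rwa [hpr]) (x i - x j)
  set a : Fin n → Fin n → ℝ := fun i j => x i (m j)
  have hlim : Filter.Tendsto (fun (K : ℕ) (q : PairIdx n) => Fmap p n a q +
      (∑' k, |x q.1.1 k - x q.1.2 k| ^ p - ∑ k ∈ Finset.range K, |x q.1.1 k - x q.1.2 k| ^ p))
      Filter.atTop (nhds (Fmap p n a)) := by
    rw [tendsto_pi_nhds]
    intro q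
    simpa using ((hsum q.1.1 q.1.2).hasSum.tendsto_sum_nat.const_sub
      (∑' k, |x q.1.1 k - x q.1.2 k| ^ p)).const_add (Fmap p n a q)
  obtain ⟨K, ⟨z, hz, hzK⟩, hK⟩ := ((hlim.eventually_mem (image_Gset_mem_nhds hp ha)).and
    (Filter.eventually_all.2 fun j => Filter.eventually_gt_atTop (m j))).exists
  refine ⟨K, fun i k => Function.extend m (z i) (fun l => x i l) k, ?_,
    fun j => ⟨m j, hK j⟩, fun i j hij => hm hij, ?_⟩
  · have key (i j : Fin n) (hij : i < j) :
        pNorm p ((fun k : Fin K => Function.extend m (z i) (fun l => x i l) k) -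
          fun k : Fin K => Function.extend m (z j) (fun l => x j l) k) = ‖x i - x j‖ := by
      have hq := congrFun hzK ⟨(i, j), hij⟩
      simp only [Fmap, a] at hq
      rw [hnorm, pNorm]
      congr 1
      simp only [Pi.sub_apply]
      rw [Fin.sum_univ_eq_sum_range (fun k => |Function.extend m (z i) (fun l => x i l) k -
        Function.extend m (z j) (fun l => x j l) k| ^ p),
        sum_extend_sub hm.injective hK (fun t => |t| ^ p), hq]
      ring
    intro i j
    rcases lt_trichotomy i j with h | rfl | h
    · exact key i j h
    · rw [pNorm_sub_self hp0, sub_self, norm_zero]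
    · rw [pNorm_sub_comm, norm_sub_rev]
      exact key j i h
  · simpa only [hm.injective.extend_apply] using hz
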